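/- Let X and Y be Polish spaces, t ≥ 1, and let C : X × P_t(Y) → ℝ ∪ {+∞} satisfy property (A). Then for every μ ∈ P(X) and ν ∈ P_t(Y), inf_{π ∈ Π(μ,ν)} ∫_X C(x,π_x) μ(dx) = sup { μ(f) + ν(g) }, where the supremum is over all f ∈ L¹(μ) and g ∈ Φ_t(Y) satisfying f(x) + p(g) ≤ C(x,p) for all x ∈ X and all p ∈ P_t(Y). -/

import Mathlib

open MeasureTheory ProbabilityTheory ENNReal NNReal

noncomputable section

/-- A probability measure has finite `t`-th moment. -/
def MemPt {Z : Type*} [MetricSpace Z] [MeasurableSpace Z] (t : ℝ)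
    (p : ProbabilityMeasure Z) : Prop :=
  ∃ z₀ : Z, Integrable (fun z => dist z z₀ ^ t) (p : Measure Z)

/-- The class `Φ_t` of continuous functions with growth of order at most `t`. -/
def PhiT (t : ℝ) (Y : Type*) [MetricSpace Y] : Set (Y → ℝ) :=
  {g | Continuous g ∧ ∃ (K : ℝ) (y₀ : Y), ∀ y, |g y| ≤ K * (1 + dist y y₀ ^ t)}

/-- The space `𝒫_t(Y)` of probability measures with finite `t`-th moment. -/
def PtSpace (t : ℝ) (Y : Type*) [MetricSpace Y] [MeasurableSpace Y] : Type _ :=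
  {p : ProbabilityMeasure Y // MemPt t p}

/-- The `t`-Wasserstein topology on `𝒫_t(Y)`: the initial topology for the maps
`p ↦ ∫ g dp`, `g ∈ Φ_t(Y)`. -/
noncomputable instance (t : ℝ) (Y : Type*) [MetricSpace Y] [MeasurableSpace Y] :
    TopologicalSpace (PtSpace t Y) :=
  ⨅ g ∈ PhiT t Y,
    TopologicalSpace.induced
      (fun p : PtSpace t Y => ∫ y, g y ∂((p.1 : Measure Y))) inferInstance

variable {X Y : Type*} [MetricSpace X] [PolishSpace X] [MeasurableSpace X] [BorelSpace X]
  [MetricSpace Y] [PolishSpace Y] [MeasurableSpace Y] [BorelSpace Y] [Nonempty Y]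

/-- `π` is a coupling of `μ` and `ν`. -/
def IsCoupling (μ : ProbabilityMeasure X) (ν : ProbabilityMeasure Y)
    (π : ProbabilityMeasure (X × Y)) : Prop :=
  (π : Measure (X × Y)).map Prod.fst = (μ : Measure X) ∧
    (π : Measure (X × Y)).map Prod.snd = (ν : Measure Y)

/-- The disintegration `x ↦ π_x` of a coupling with respect to its first marginal,
as a map into probability measures. -/
noncomputable def disint (π : ProbabilityMeasure (X × Y)) (x : X) : ProbabilityMeasure Y :=
  ⟨(π : Measure (X × Y)).condKernel x, inferInstance⟩

/-- The weak transport cost `∫ C(x, π_x) μ(dx)` of a coupling `π`. -/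
noncomputable def weakCost (C : X → ProbabilityMeasure Y → ℝ≥0∞)
    (μ : ProbabilityMeasure X) (π : ProbabilityMeasure (X × Y)) : ℝ≥0∞ :=
  ∫⁻ x, C x (disint π x) ∂(μ : Measure X)

open Filter Topology

/-- A function on `S` that is lower semicontinuous for the topology induced by `j : S → W` is the
supremum of an increasing sequence of bounded continuous functions on `W`. -/
theorem exists_monotone_continuousMap_iSup_eq {S W : Type*} [PseudoMetricSpace W]
    (j : S → W) (F : S → ℝ≥0∞)
    (hF : ∀ s, ∀ a < F s, ∀ᶠ w in 𝓝 (j s), ∀ s', j s' = w → a < F s') :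
    ∃ H : ℕ → C(W, ℝ≥0), Monotone H ∧ (∀ n w, H n w ≤ n) ∧
      ∀ s, ⨆ n, (H n (j s) : ℝ≥0∞) = F s := by
  let H : ℕ → W → ℝ≥0∞ := fun n w => min n (⨅ s, F s + n * edist w (j s))
  have hle : ∀ n w, H n w ≤ n := fun n w => min_le_left _ _
  have hfin : ∀ n w, H n w ≠ ∞ := fun n w => ((hle n w).trans_lt (ENNReal.natCast_lt_top n)).ne
  have hmono : ∀ w, Monotone fun n => H n w := fun w m n hmn => by
    dsimp only [H]
    gcongr
  have hcont : ∀ n, Continuous (H n) := fun n => by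
    refine continuous_const.min (continuous_of_le_add_edist n (ENNReal.natCast_ne_top n) ?_)
    intro x y
    rw [ENNReal.iInf_add]
    refine le_iInf fun s => (iInf_le _ s).trans ?_
    rw [add_assoc, ← mul_add, add_comm (edist y _)]
    gcongr
    exact edist_triangle _ _ _
  refine ⟨fun n => ⟨fun w => (H n w).toNNReal, ?_⟩, ?_, ?_, ?_⟩
  · exact ENNReal.continuousOn_toNNReal.comp_continuous (hcont n) (hfin n)
  · intro m n hmn w
    exact ENNReal.toNNReal_mono (hfin n w) (hmono w hmn)
  · intro n w
    exact (ENNReal.toNNReal_mono (ENNReal.natCast_ne_top n) (hle n w)).trans_eq (by simp)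
  · intro s
    simp only [ContinuousMap.coe_mk, ENNReal.coe_toNNReal (hfin _ _)]
    apply le_antisymm
    · refine iSup_le fun n => (min_le_right _ _).trans ((iInf_le _ s).trans ?_)
      simp
    · refine le_of_forall_lt fun a ha => ?_
      obtain ⟨b, hab, hb⟩ := exists_between ha
      obtain ⟨ε, hε, hball⟩ := EMetric.mem_nhds_iff.1 (hF s b hb)
      have hbtop : b ≠ ∞ := (hb.trans_le le_top).ne
      obtain ⟨n, hn⟩ : ∃ n : ℕ, b ≤ n ∧ b ≤ n * ε := by
        obtain ⟨n₁, hn₁⟩ := ENNReal.exists_nat_gt hbtop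
        obtain ⟨n₂, hn₂⟩ := ENNReal.exists_nat_mul_gt hε.ne' hbtop
        refine ⟨max n₁ n₂, hn₁.le.trans (by simp), hn₂.le.trans ?_⟩
        gcongr
        simp
      refine hab.trans_le (le_iSup_of_le n (le_min hn.1 (le_iInf fun s' => ?_)))
      by_cases hs' : edist (j s') (j s) < ε
      · exact (hball hs' s' rfl).le.trans le_self_add
      · refine hn.2.trans (le_trans ?_ le_add_self)
        gcongr
        rw [edist_comm]
        exact not_lt.1 hs'

/-- A consistent convex cone of linear constraints `∫ h dP ≤ v` on a compact space is satisfied by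
some probability measure `P`. -/
theorem exists_probabilityMeasure_integral_le {W : Type*} [TopologicalSpace W] [CompactSpace W]
    [T2Space W] [MeasurableSpace W] [BorelSpace W] (K : Set (C(W, ℝ) × ℝ))
    (hadd : ∀ p ∈ K, ∀ q ∈ K, p + q ∈ K)
    (hsmul : ∀ c : ℝ, 0 < c → ∀ p ∈ K, c • p ∈ K)
    (hconst : ∀ (c : ℝ) (h : C(W, ℝ)), (∀ w, h w ≤ c) → (h, c) ∈ K)
    (hzero : ∀ v : ℝ, (0, v) ∈ K → 0 ≤ v) :
    ∃ P : ProbabilityMeasure W, ∀ p ∈ K, ∫ w, p.1 w ∂(P : Measure W) ≤ p.2 := by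
  let V : C(W, ℝ) → Set ℝ := fun h => {v | (h, v) ∈ K}
  let N : C(W, ℝ) → ℝ := fun h => sInf (V h)
  have hne : ∀ h, (V h).Nonempty := fun h =>
    ⟨‖h‖, hconst _ _ fun w => (le_abs_self _).trans (h.norm_coe_le_norm w)⟩
  have hbdd : ∀ h, BddBelow (V h) := fun h => ⟨-‖h‖, fun v hv => by
    have h1 : (-h, ‖h‖) ∈ K :=
      hconst _ _ fun w => (neg_le_abs _).trans (h.norm_coe_le_norm w)
    have h2 := hzero (v + ‖h‖) (by simpa using hadd _ hv _ h1)
    linarith⟩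
  have N_le : ∀ h v, (h, v) ∈ K → N h ≤ v := fun h v hv => csInf_le (hbdd h) hv
  have N_add : ∀ h₁ h₂, N (h₁ + h₂) ≤ N h₁ + N h₂ := fun h₁ h₂ => by
    refine le_of_forall_pos_lt_add fun ε hε => ?_
    obtain ⟨v₁, hv₁, h1⟩ := exists_lt_of_csInf_lt (hne h₁) (lt_add_of_pos_right (N h₁) (half_pos hε))
    obtain ⟨v₂, hv₂, h2⟩ := exists_lt_of_csInf_lt (hne h₂) (lt_add_of_pos_right (N h₂) (half_pos hε))
    have := N_le _ _ (hadd _ hv₁ _ hv₂)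
    simp only [] at this
    linarith
  have N_le_smul : ∀ c : ℝ, 0 < c → ∀ h, N (c • h) ≤ c * N h := fun c hc h => by
    rw [← div_le_iff₀' hc]
    refine le_csInf (hne h) fun v hv => ?_
    rw [div_le_iff₀' hc]
    exact N_le _ _ (hsmul c hc _ hv)
  have N_hom : ∀ c : ℝ, 0 < c → ∀ h, N (c • h) = c * N h := fun c hc h => by
    refine (N_le_smul c hc h).antisymm ?_
    have := N_le_smul c⁻¹ (inv_pos.2 hc) (c • h)
    rw [smul_smul, inv_mul_cancel₀ hc.ne', one_smul] at this
    rwa [le_inv_mul_iff₀ hc] at this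
  have N_zero : N 0 = 0 := by
    have := N_hom 2 two_pos 0
    rw [smul_zero] at this
    linarith
  obtain ⟨L, -, hL⟩ := exists_extension_of_le_sublinear (⟨⊥, 0⟩ : C(W, ℝ) →ₗ.[ℝ] ℝ) N N_hom N_add
    (by rintro ⟨x, hx⟩; obtain rfl := (Submodule.mem_bot ℝ).1 hx; simp [N_zero])
  have L_le : ∀ (c : ℝ) (h : C(W, ℝ)), (∀ w, h w ≤ c) → L h ≤ c := fun c h hc =>
    (hL h).trans (N_le _ _ (hconst c h hc))
  let Λ₀ : CompactlySupportedContinuousMap W ℝ →ₗ[ℝ] ℝ :=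
    { toFun := fun f => L f.toContinuousMap
      map_add' := fun f g => L.map_add _ _
      map_smul' := fun c f => L.map_smul _ _ }
  have Λ₀_nonneg : ∀ f : CompactlySupportedContinuousMap W ℝ, 0 ≤ f → 0 ≤ Λ₀ f := fun f hf => by
    have := L_le 0 (-f.toContinuousMap) fun w => neg_nonpos.2 (hf w)
    rw [map_neg] at this
    exact neg_nonpos.1 this
  let Λ : CompactlySupportedContinuousMap W ℝ →ₚ[ℝ] ℝ := PositiveLinearMap.mk₀ Λ₀ Λ₀_nonneg
  have hinteg : ∀ h : C(W, ℝ), ∫ w, h w ∂(RealRMK.rieszMeasure Λ) = L h := fun h =>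
    RealRMK.integral_rieszMeasure Λ (CompactlySupportedContinuousMap.continuousMapEquiv h)
  have hone : L 1 = 1 := by
    refine le_antisymm (L_le 1 1 fun _ => le_rfl) ?_
    have := L_le (-1) (-1) fun _ => le_rfl
    rw [map_neg] at this
    linarith
  have hprob : IsProbabilityMeasure (RealRMK.rieszMeasure Λ) := by
    have := hinteg 1
    rw [hone] at this
    simp only [ContinuousMap.one_apply, integral_const, smul_eq_mul, mul_one] at this
    exact isProbabilityMeasure_iff_real.2 this
  exact ⟨⟨_, hprob⟩, fun p hp => (hinteg p.1).trans_le ((hL _).trans (N_le _ _ hp))⟩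

theorem dist_rpow_le_two_rpow_mul {Z : Type*} [PseudoMetricSpace Z] {t : ℝ} (ht : 0 ≤ t)
    (x y z : Z) : dist x z ^ t ≤ 2 ^ t * (dist x y ^ t + dist y z ^ t) := by
  have h1 : dist x z ≤ 2 * max (dist x y) (dist y z) :=
    (dist_triangle x y z).trans (by
      linarith [le_max_left (dist x y) (dist y z), le_max_right (dist x y) (dist y z)])
  calc dist x z ^ t ≤ (2 * max (dist x y) (dist y z)) ^ t :=
        Real.rpow_le_rpow dist_nonneg h1 ht
    _ = 2 ^ t * max (dist x y) (dist y z) ^ t :=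
        Real.mul_rpow two_pos.le (le_max_of_le_left dist_nonneg)
    _ ≤ _ := by
        gcongr
        have h2 : 0 ≤ dist x y ^ t := by positivity
        have h3 : 0 ≤ dist y z ^ t := by positivity
        rcases max_choice (dist x y) (dist y z) with h | h <;> rw [h] <;> linarith

theorem PhiT.exists_bound {Z : Type*} [MetricSpace Z] {t : ℝ} (ht : 0 ≤ t) {g : Z → ℝ}
    (hg : g ∈ PhiT t Z) (z₀ : Z) : ∃ K : ℝ, 0 ≤ K ∧ ∀ z, |g z| ≤ K * (1 + dist z z₀ ^ t) := by
  obtain ⟨-, K, z₁, hK⟩ := hg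
  refine ⟨|K| * (1 + 2 ^ t * (1 + dist z₀ z₁ ^ t)), by positivity, fun z => (hK z).trans ?_⟩
  have h1 := dist_rpow_le_two_rpow_mul ht z z₀ z₁
  have h2 : 0 ≤ dist z z₁ ^ t := by positivity
  have h3 : 0 ≤ dist z z₀ ^ t := by positivity
  have h4 : 0 ≤ dist z₀ z₁ ^ t := by positivity
  have h5 : (0 : ℝ) ≤ 2 ^ t := by positivity
  rw [mul_assoc]
  refine mul_le_mul (le_abs_self K) ?_ (by positivity) (abs_nonneg K)
  nlinarith [mul_nonneg h5 h3, mul_nonneg h5 h4, mul_nonneg (mul_nonneg h5 h3) h4]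

theorem PhiT.of_bounded {Z : Type*} [MetricSpace Z] [Nonempty Z] {t : ℝ} {g : Z → ℝ}
    (hg : Continuous g) (M : ℝ) (hM : ∀ z, |g z| ≤ M) : g ∈ PhiT t Z := by
  inhabit Z
  refine ⟨hg, M, default, fun z => (hM z).trans ?_⟩
  have h1 : 0 ≤ M := (abs_nonneg _).trans (hM z)
  have h2 : 0 ≤ dist z default ^ t := by positivity
  nlinarith

theorem PhiT.const {Z : Type*} [MetricSpace Z] [Nonempty Z] {t : ℝ} (c : ℝ) :
    (fun _ : Z => c) ∈ PhiT t Z :=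
  PhiT.of_bounded continuous_const |c| fun _ => le_rfl

theorem PhiT.dist_rpow {Z : Type*} [MetricSpace Z] {t : ℝ} (ht : 0 ≤ t) (z₀ : Z) :
    (fun z => dist z z₀ ^ t) ∈ PhiT t Z := by
  refine ⟨(continuous_id.dist continuous_const).rpow_const fun _ => Or.inr ht, 1, z₀, fun z => ?_⟩
  rw [abs_of_nonneg (by positivity)]
  linarith

theorem PhiT.add {Z : Type*} [MetricSpace Z] {t : ℝ} (ht : 0 ≤ t) {g h : Z → ℝ}
    (hg : g ∈ PhiT t Z) (hh : h ∈ PhiT t Z) : (fun z => g z + h z) ∈ PhiT t Z := by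
  obtain ⟨-, -, z₀, -⟩ := id hg
  obtain ⟨K, -, hK⟩ := PhiT.exists_bound ht hg z₀
  obtain ⟨L, -, hL⟩ := PhiT.exists_bound ht hh z₀
  refine ⟨hg.1.add hh.1, K + L, z₀, fun z => (abs_add_le _ _).trans ?_⟩
  rw [add_mul]
  exact add_le_add (hK z) (hL z)

theorem PhiT.const_mul {Z : Type*} [MetricSpace Z] {t : ℝ} {g : Z → ℝ}
    (hg : g ∈ PhiT t Z) (c : ℝ) : (fun z => c * g z) ∈ PhiT t Z := by
  obtain ⟨hc, K, z₀, hK⟩ := hg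
  refine ⟨hc.const_mul c, |c| * K, z₀, fun z => ?_⟩
  rw [abs_mul, mul_assoc]
  exact mul_le_mul_of_nonneg_left (hK z) (abs_nonneg c)

theorem PhiT.sum {Z ι : Type*} [MetricSpace Z] [Nonempty Z] {t : ℝ} (ht : 0 ≤ t) (s : Finset ι)
    {g : ι → Z → ℝ} (hg : ∀ i, g i ∈ PhiT t Z) : (fun z => ∑ i ∈ s, g i z) ∈ PhiT t Z := by
  classical
  induction s using Finset.induction_on with
  | empty => simpa using PhiT.const (0 : ℝ)
  | insert i s his ih =>
    simp only [Finset.sum_insert his]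
    exact PhiT.add ht (hg i) ih

omit [PolishSpace Y] [Nonempty Y] in
theorem MemPt.integrable [SecondCountableTopology Y] {t : ℝ} (ht : 0 ≤ t)
    {p : ProbabilityMeasure Y} (hp : MemPt t p)
    {g : Y → ℝ} (hg : g ∈ PhiT t Y) : Integrable g (p : Measure Y) := by
  obtain ⟨z₀, hz₀⟩ := hp
  obtain ⟨K, -, hK⟩ := PhiT.exists_bound ht hg z₀
  exact (((integrable_const 1).add hz₀).const_mul K).mono' hg.1.aestronglyMeasurable
    (ae_of_all _ hK)

omit [PolishSpace Y] [Nonempty Y] in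
theorem memPt_of_lintegral_ne_top [SecondCountableTopology Y] {t : ℝ} (ht : 0 ≤ t) {p : ProbabilityMeasure Y} (y₀ : Y)
    (h : ∫⁻ y, ENNReal.ofReal (dist y y₀ ^ t) ∂(p : Measure Y) ≠ ∞) : MemPt t p :=
  ⟨y₀, (PhiT.dist_rpow ht y₀).1.aestronglyMeasurable,
    (hasFiniteIntegral_iff_ofReal (ae_of_all _ fun y => by positivity)).2 h.lt_top⟩

theorem PtSpace.isInducing_integral (t : ℝ) (Y : Type*) [MetricSpace Y] [MeasurableSpace Y] :
    IsInducing fun (p : PtSpace t Y) (g : PhiT t Y) => ∫ y, g.1 y ∂(p.1 : Measure Y) := by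
  constructor
  rw [Pi.topologicalSpace, induced_iInf]
  simp only [induced_compose]
  exact iInf_subtype'

/-- A lower semicontinuous convex function `F ≥ 0` on `𝒫_t(Y)` is the supremum of the affine
functions `p ↦ a + ∫ g dp`, `g ∈ Φ_t(Y)`, below it. -/
theorem exists_affine_minorant {t : ℝ} (ht : 0 ≤ t) (F : ProbabilityMeasure Y → ℝ≥0∞)
    (hlsc : LowerSemicontinuous fun p : PtSpace t Y => F p.1)
    (hconv : ∀ p q r : ProbabilityMeasure Y, MemPt t p → MemPt t q →
      ∀ a b : ℝ≥0, a + b = 1 →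
      (r : Measure Y) = (a : ℝ≥0∞) • (p : Measure Y) + (b : ℝ≥0∞) • (q : Measure Y) →
      F r ≤ (a : ℝ≥0∞) * F p + (b : ℝ≥0∞) * F q)
    (p₀ : ProbabilityMeasure Y) (hp₀ : MemPt t p₀) (D : ℝ) (hD : ENNReal.ofReal D < F p₀) :
    ∃ g ∈ PhiT t Y, ∃ a : ℝ,
      (∀ p : ProbabilityMeasure Y, MemPt t p →
        ENNReal.ofReal (a + ∫ y, g y ∂(p : Measure Y)) ≤ F p) ∧
      D < a + ∫ y, g y ∂(p₀ : Measure Y) := by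
  classical
  obtain ⟨D', hDD', hD'⟩ := exists_between hD
  have hDtop : D' ≠ ∞ := (hD'.trans_le le_top).ne
  have hDlt : D < D'.toReal := by
    by_contra! h
    exact absurd (ENNReal.ofReal_le_ofReal h) (by rwa [ENNReal.ofReal_toReal hDtop, not_le])
  have hnhds := hlsc ⟨p₀, hp₀⟩ D' hD'
  have := (PtSpace.isInducing_integral t Y).nhds_eq_comap ⟨p₀, hp₀⟩
  rw [this, Filter.eventually_comap, nhds_pi] at hnhds
  obtain ⟨I, hI, U, hU, hIU⟩ := Filter.mem_pi.1 hnhds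
  have := hI.to_subtype
  have := Fintype.ofFinite I
  let e : ProbabilityMeasure Y → I → ℝ := fun p i => ∫ y, i.1.1 y ∂(p : Measure Y)
  let A : Set ((I → ℝ) × ℝ) :=
    {z | ∃ p : ProbabilityMeasure Y, MemPt t p ∧ z.1 = e p ∧ F p ≤ ENNReal.ofReal z.2 ∧ 0 ≤ z.2}
  have hAconv : Convex ℝ A := by
    rintro ⟨_, c⟩ ⟨p, hp, rfl, hpc, hc⟩ ⟨_, d⟩ ⟨q, hq, rfl, hqd, hd⟩ a b ha hb hab
    lift a to ℝ≥0 using ha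
    lift b to ℝ≥0 using hb
    have hab' : a + b = 1 := by exact_mod_cast hab
    have hr : IsProbabilityMeasure
        ((a : ℝ≥0∞) • (p : Measure Y) + (b : ℝ≥0∞) • (q : Measure Y)) := by
      constructor
      simp only [Measure.coe_add, Measure.coe_smul, Pi.add_apply, Pi.smul_apply, measure_univ,
        smul_eq_mul, mul_one]
      exact_mod_cast hab'
    have hinteg : ∀ g ∈ PhiT t Y, Integrable g
        ((a : ℝ≥0∞) • (p : Measure Y) + (b : ℝ≥0∞) • (q : Measure Y)) := fun g hg =>
      ((hp.integrable ht hg).smul_measure ENNReal.coe_ne_top).add_measure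
        ((hq.integrable ht hg).smul_measure ENNReal.coe_ne_top)
    refine ⟨⟨_, hr⟩, ?_, ?_, ?_, ?_⟩
    · obtain ⟨z₀, -⟩ := id hp
      exact ⟨z₀, hinteg _ (PhiT.dist_rpow ht z₀)⟩
    · funext i
      change a • (e p i) + b • (e q i) = ∫ y, i.1.1 y ∂_
      rw [ProbabilityMeasure.coe_mk, integral_add_measure
        ((hp.integrable ht i.1.2).smul_measure ENNReal.coe_ne_top)
        ((hq.integrable ht i.1.2).smul_measure ENNReal.coe_ne_top),
        integral_smul_measure, integral_smul_measure]
      rfl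
    · refine (hconv p q _ hp hq a b hab' rfl).trans ?_
      have h1 : ENNReal.ofReal ((a : ℝ) * c + b * d) =
          a * ENNReal.ofReal c + b * ENNReal.ofReal d := by
        rw [ENNReal.ofReal_add (by positivity) (by positivity),
          ENNReal.ofReal_mul a.coe_nonneg, ENNReal.ofReal_mul b.coe_nonneg,
          ENNReal.ofReal_coe_nnreal, ENNReal.ofReal_coe_nnreal]
      refine le_trans ?_ h1.ge
      gcongr
    · change 0 ≤ (a : ℝ) * c + b * d
      positivity
  have hnot : (e p₀, D) ∉ closure A := by
    intro hmem
    have hV : {v : I → ℝ | ∀ i, v i ∈ U i.1} ∈ 𝓝 (e p₀) := by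
      have : (Set.univ : Set I).pi (fun i => U i.1) ∈ 𝓝 (e p₀) :=
        set_pi_mem_nhds Set.finite_univ fun i _ => hU i.1
      simpa [Set.pi] using this
    obtain ⟨⟨v, c⟩, ⟨hv, hc⟩, p, hp, rfl, hpc, -⟩ :=
      mem_closure_iff_nhds.1 hmem _ (prod_mem_nhds hV (Iio_mem_nhds hDlt))
    have hmemU : (fun g : PhiT t Y => ∫ y, g.1 y ∂(p : Measure Y)) ∈ I.pi U :=
      fun i hi => hv ⟨i, hi⟩
    have h1 : D' < F p := hIU hmemU ⟨p, hp⟩ rfl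
    have h2 : ENNReal.ofReal c ≤ D' := ENNReal.ofReal_le_of_le_toReal (le_of_lt hc)
    exact absurd (h1.trans_le (hpc.trans h2)) (lt_irrefl _)
  obtain ⟨φ, u, hφ₀, hφ⟩ := geometric_hahn_banach_point_closed hAconv.closure isClosed_closure hnot
  let G : Y → ℝ := fun y => ∑ i : I, φ (Pi.single i 1, 0) * i.1.1 y
  let l : ℝ := φ (0, 1)
  have hG : G ∈ PhiT t Y := PhiT.sum ht _ fun i => PhiT.const_mul i.1.2 _
  have hφG : ∀ p : ProbabilityMeasure Y, MemPt t p → ∀ c : ℝ,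
      φ (e p, c) = ∫ y, G y ∂(p : Measure Y) + l * c := fun p hp c => by
    have h1 : (e p, c) = (∑ i : I, e p i • (Pi.single i (1 : ℝ), (0 : ℝ))) + c • ((0 : I → ℝ), (1 : ℝ)) := by
      ext1
      · funext k
        simp [Prod.fst_sum, Finset.sum_apply, Pi.single_apply]
      · simp [Prod.snd_sum]
    rw [h1, map_add, map_sum, map_smul, integral_finsetSum]
    · simp only [map_smul, smul_eq_mul, integral_const_mul]
      congr 1
      · exact Finset.sum_congr rfl fun i _ => mul_comm _ _
      · exact mul_comm _ _
    · exact fun i _ => (hp.integrable ht i.1.2).const_mul _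
  rw [hφG p₀ hp₀] at hφ₀
  have hsep : ∀ p : ProbabilityMeasure Y, MemPt t p → ∀ c : ℝ, 0 ≤ c → F p ≤ ENNReal.ofReal c →
      u < ∫ y, G y ∂(p : Measure Y) + l * c := fun p hp c hc hpc => by
    rw [← hφG p hp]
    exact hφ _ (subset_closure ⟨p, hp, rfl, hpc, hc⟩)
  have key : ∀ s : ℝ, 0 ≤ s →
      (∀ p : ProbabilityMeasure Y, MemPt t p → ∀ c : ℝ, 0 ≤ c → F p ≤ ENNReal.ofReal c →
        s * (u - ∫ y, G y ∂(p : Measure Y)) ≤ c) →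
      D < s * (u - ∫ y, G y ∂(p₀ : Measure Y)) → ∃ g ∈ PhiT t Y, ∃ a : ℝ,
        (∀ p : ProbabilityMeasure Y, MemPt t p →
          ENNReal.ofReal (a + ∫ y, g y ∂(p : Measure Y)) ≤ F p) ∧
        D < a + ∫ y, g y ∂(p₀ : Measure Y) := fun s hs h1 h2 => by
    refine ⟨fun y => (-s) * G y, PhiT.const_mul hG _, s * u, fun p hp => ?_, ?_⟩
    · rw [integral_const_mul]
      by_cases htop : F p = ∞
      · simp [htop]
      · refine ENNReal.ofReal_le_of_le_toReal ?_
        have := h1 p hp (F p).toReal ENNReal.toReal_nonneg (ENNReal.ofReal_toReal htop).ge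
        linarith
    · rw [integral_const_mul]
      linarith
  by_cases hex : ∃ p : ProbabilityMeasure Y, MemPt t p ∧ F p ≠ ∞
  · obtain ⟨p, hp, hptop⟩ := hex
    have hl : 0 ≤ l := by
      by_contra! hl
      set m := ∫ y, G y ∂(p : Measure Y)
      have h1 := hsep p hp (max (F p).toReal (max 0 ((m - u) / (-l))))
        (le_max_of_le_right (le_max_left _ _))
        ((ENNReal.ofReal_toReal hptop).ge.trans (ENNReal.ofReal_le_ofReal (le_max_left _ _)))
      have h2 : (m - u) / (-l) ≤ max (F p).toReal (max 0 ((m - u) / (-l))) :=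
        le_max_of_le_right (le_max_right _ _)
      rw [div_le_iff₀ (neg_pos.2 hl)] at h2
      linarith
    rcases hl.eq_or_lt with hl0 | hlpos
    · rw [← hl0] at hφ₀ hsep
      set m := ∫ y, G y ∂(p₀ : Measure Y)
      have hm : 0 < u - m := by linarith
      refine key ((|D| + 1) / (u - m)) (by positivity) (fun q hq c hc hqc => ?_) ?_
      · have := hsep q hq c hc hqc
        refine le_trans (mul_nonpos_of_nonneg_of_nonpos (by positivity) (by linarith)) hc
      · rw [div_mul_cancel₀ _ hm.ne']
        linarith [le_abs_self D]
    · refine key l⁻¹ (by positivity) (fun q hq c hc hqc => ?_) ?_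
      · rw [inv_mul_le_iff₀ hlpos]
        linarith [hsep q hq c hc hqc]
      · rw [lt_inv_mul_iff₀ hlpos]
        linarith
  · push Not at hex
    refine ⟨fun _ => 0, PhiT.const 0, D + 1, fun p hp => ?_, by simp⟩
    rw [hex p hp]
    exact le_top

theorem integral_bind_kernel {Ω Z : Type*} [MeasurableSpace Ω] [MeasurableSpace Z] (κ : Measure Ω)
    [SFinite κ] (η : Kernel Ω Z) [IsSFiniteKernel η] {f : Z → ℝ} (hf : Integrable f (κ.bind η)) :
    (∀ᵐ ω ∂κ, Integrable f (η ω)) ∧ Integrable (fun ω => ∫ z, f z ∂(η ω)) κ ∧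
      ∫ z, f z ∂(κ.bind η) = ∫ ω, ∫ z, f z ∂(η ω) ∂κ := by
  rw [← Measure.snd_compProd, Measure.snd] at hf ⊢
  have hf' : Integrable (fun q : Ω × Z => f q.2) (κ ⊗ₘ η) := hf.comp_measurable measurable_snd
  have hf'' : Integrable (fun q : Ω × Z => f q.2)
    ((Kernel.const Unit κ ⊗ₖ Kernel.prodMkLeft Unit η) ()) := hf'
  refine ⟨hf''.ae_of_compProd, hf''.integral_compProd, ?_⟩
  rw [integral_map measurable_snd.aemeasurable hf.1, Measure.integral_compProd hf']

theorem ofReal_integral_le_lintegral_ofReal {Ω : Type*} [MeasurableSpace Ω] {κ : Measure Ω}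
    {f : Ω → ℝ} (hf : Integrable f κ) :
    ENNReal.ofReal (∫ ω, f ω ∂κ) ≤ ∫⁻ ω, ENNReal.ofReal (f ω) ∂κ := by
  have h1 : Integrable (fun ω => max (f ω) 0) κ := hf.pos_part
  calc ENNReal.ofReal (∫ ω, f ω ∂κ) ≤ ENNReal.ofReal (∫ ω, max (f ω) 0 ∂κ) :=
        ENNReal.ofReal_le_ofReal (integral_mono hf h1 fun ω => le_max_left _ _)
    _ = ∫⁻ ω, ENNReal.ofReal (max (f ω) 0) ∂κ :=
        ofReal_integral_eq_lintegral_ofReal h1 (ae_of_all _ fun ω => le_max_right _ _)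
    _ = _ := by simp

/-- **Jensen's inequality** for a convex lower semicontinuous function on `𝒫_t(Y)` and the mixture
`r` of a Markov kernel `η`. -/
theorem le_lintegral_of_eq_bind {t : ℝ} (ht : 0 ≤ t) (F : ProbabilityMeasure Y → ℝ≥0∞)
    (hlsc : LowerSemicontinuous fun p : PtSpace t Y => F p.1)
    (hconv : ∀ p q r : ProbabilityMeasure Y, MemPt t p → MemPt t q →
      ∀ a b : ℝ≥0, a + b = 1 →
      (r : Measure Y) = (a : ℝ≥0∞) • (p : Measure Y) + (b : ℝ≥0∞) • (q : Measure Y) →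
      F r ≤ (a : ℝ≥0∞) * F p + (b : ℝ≥0∞) * F q)
    {Ω : Type*} [MeasurableSpace Ω] (κ : Measure Ω) [IsProbabilityMeasure κ] (η : Kernel Ω Y)
    [IsMarkovKernel η] (r : ProbabilityMeasure Y) (hr : (r : Measure Y) = κ.bind η)
    (hrt : MemPt t r) (Φ : Ω → ℝ≥0∞)
    (hΦ : ∀ᵐ ω ∂κ, ∃ p : ProbabilityMeasure Y, (p : Measure Y) = η ω ∧ MemPt t p ∧ F p ≤ Φ ω) :
    F r ≤ ∫⁻ ω, Φ ω ∂κ := by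
  refine le_of_forall_lt fun a ha => ?_
  obtain ⟨b, hab, hb⟩ := exists_between ha
  have hbtop : b ≠ ∞ := (hb.trans_le le_top).ne
  rw [← ENNReal.ofReal_toReal hbtop] at hb
  obtain ⟨g, hg, c, hgF, hlt⟩ := exists_affine_minorant ht F hlsc hconv r hrt _ hb
  have hinteg : Integrable (fun y => c + g y) (κ.bind η) := by
    rw [← hr]
    exact (integrable_const c).add (hrt.integrable ht hg)
  have heq : c + ∫ y, g y ∂(r : Measure Y) = ∫ ω, ∫ y, (c + g y) ∂(η ω) ∂κ := by
    rw [← (integral_bind_kernel κ η hinteg).2.2, ← hr,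
      integral_add (integrable_const c) (hrt.integrable ht hg)]
    simp
  calc a < b := hab
    _ = ENNReal.ofReal b.toReal := (ENNReal.ofReal_toReal hbtop).symm
    _ ≤ ENNReal.ofReal (∫ ω, ∫ y, (c + g y) ∂(η ω) ∂κ) := ENNReal.ofReal_le_ofReal (heq ▸ hlt.le)
    _ ≤ ∫⁻ ω, ENNReal.ofReal (∫ y, (c + g y) ∂(η ω)) ∂κ :=
        ofReal_integral_le_lintegral_ofReal (integral_bind_kernel κ η hinteg).2.1
    _ ≤ ∫⁻ ω, Φ ω ∂κ := by
        refine lintegral_mono_ae ?_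
        filter_upwards [hΦ] with ω ⟨p, hpω, hp, hpΦ⟩
        refine le_trans ?_ hpΦ
        rw [← hpω, integral_add (integrable_const c) (hp.integrable ht hg)]
        simpa using hgF p hp

omit [MetricSpace X] [PolishSpace X] [BorelSpace X] in
theorem IsCoupling.eq_bind_condKernel {μ : ProbabilityMeasure X} {ν : ProbabilityMeasure Y}
    {π : ProbabilityMeasure (X × Y)} (hπ : IsCoupling μ ν π) :
    (ν : Measure Y) = (μ : Measure X).bind (π : Measure (X × Y)).condKernel := by
  rw [← hπ.2, ← hπ.1]
  change Measure.snd _ = (Measure.fst _).bind _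
  rw [← Measure.snd_compProd, Measure.disintegrate]

omit [MetricSpace X] [PolishSpace X] [BorelSpace X] in
/-- Weak duality. -/
theorem ofReal_integral_add_integral_le_weakCost {t : ℝ} (ht : 0 ≤ t)
    {C : X → ProbabilityMeasure Y → ℝ≥0∞} {μ : ProbabilityMeasure X} {ν : ProbabilityMeasure Y}
    (hν : MemPt t ν) {π : ProbabilityMeasure (X × Y)} (hπ : IsCoupling μ ν π)
    {f : X → ℝ} {g : Y → ℝ} (hf : Integrable f (μ : Measure X)) (hg : g ∈ PhiT t Y)
    (hfg : ∀ (x : X) (p : ProbabilityMeasure Y), MemPt t p →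
      ENNReal.ofReal (f x + ∫ y, g y ∂(p : Measure Y)) ≤ C x p) :
    ENNReal.ofReal (∫ x, f x ∂(μ : Measure X) + ∫ y, g y ∂(ν : Measure Y)) ≤ weakCost C μ π := by
  have hb := hπ.eq_bind_condKernel
  have hgi := hν.integrable ht hg
  obtain ⟨z₀, hz₀⟩ := hν
  rw [hb] at hgi hz₀ ⊢
  obtain ⟨-, h1, h2⟩ := integral_bind_kernel _ _ hgi
  rw [h2, ← integral_add hf h1]
  refine (ofReal_integral_le_lintegral_ofReal (hf.add h1)).trans (lintegral_mono_ae ?_)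
  filter_upwards [(integral_bind_kernel _ _ hz₀).1] with x hx
  exact hfg x (disint π x) ⟨z₀, hx⟩

omit [PolishSpace Y] [Nonempty Y] in
theorem eventually_lt_lintegral_of_tendsto_map {Q ι : Type*} [MetricSpace Q] [CompactSpace Q]
    [MeasurableSpace Q] [BorelSpace Q] {k : Y → Q} (hk : IsEmbedding k) {L : Filter ι}
    {p : ι → ProbabilityMeasure Y} {p₀ : ProbabilityMeasure Y}
    (h : Tendsto (fun i => (p i).map hk.continuous.measurable.aemeasurable) L
      (𝓝 (p₀.map hk.continuous.measurable.aemeasurable)))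
    {φ : Y → ℝ≥0∞} (hφ : Continuous φ) {a : ℝ≥0∞} (ha : a < ∫⁻ y, φ y ∂(p₀ : Measure Y)) :
    ∀ᶠ i in L, a < ∫⁻ y, φ y ∂(p i : Measure Y) := by
  obtain ⟨H, hmono, -, hsup⟩ := exists_monotone_continuousMap_iSup_eq k φ fun y b hb => by
    have h1 := hφ.continuousAt.eventually (lt_mem_nhds hb)
    rwa [hk.isInducing.nhds_eq_comap, eventually_comap] at h1
  have hlin : ∀ q : ProbabilityMeasure Y, ∫⁻ y, φ y ∂(q : Measure Y) =
      ⨆ n, ∫⁻ z, H n z ∂(q.map hk.continuous.measurable.aemeasurable : Measure Q) := fun q => by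
    simp_rw [← hsup, ProbabilityMeasure.toMeasure_map]
    rw [lintegral_iSup]
    · congr 1
      funext n
      rw [lintegral_map (by fun_prop) hk.continuous.measurable]
    · exact fun n => ((map_continuous (H n)).measurable.comp hk.continuous.measurable).coe_nnreal_ennreal
    · exact fun m n hmn y => ENNReal.coe_le_coe.2 (hmono hmn _)
  rw [hlin, lt_iSup_iff] at ha
  obtain ⟨n, hn⟩ := ha
  have h2 := ((ProbabilityMeasure.continuous_lintegral_continuousMap (H n)).tendsto _).comp h
  filter_upwards [h2.eventually (lt_mem_nhds hn)] with i hi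
  rw [hlin]
  exact lt_iSup_iff.2 ⟨n, hi⟩

omit [Nonempty Y] in
theorem tendsto_integral_of_tendsto_map {Q ι : Type*} [MetricSpace Q] [CompactSpace Q]
    [MeasurableSpace Q] [BorelSpace Q] {k : Y → Q} (hk : IsEmbedding k) {L : Filter ι}
    {p : ι → ProbabilityMeasure Y} {p₀ : ProbabilityMeasure Y}
    (h : Tendsto (fun i => (p i).map hk.continuous.measurable.aemeasurable) L
      (𝓝 (p₀.map hk.continuous.measurable.aemeasurable)))
    {t : ℝ} (ht : 0 ≤ t) (hp : ∀ i, MemPt t (p i)) (hp₀ : MemPt t p₀) (y₀ : Y)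
    (hm : Tendsto (fun i => ∫ y, dist y y₀ ^ t ∂(p i : Measure Y)) L
      (𝓝 (∫ y, dist y y₀ ^ t ∂(p₀ : Measure Y))))
    {g : Y → ℝ} (hg : g ∈ PhiT t Y) :
    Tendsto (fun i => ∫ y, g y ∂(p i : Measure Y)) L (𝓝 (∫ y, g y ∂(p₀ : Measure Y))) := by
  have : Nonempty Y := ⟨y₀⟩
  obtain ⟨K, hK0, hK⟩ := PhiT.exists_bound ht hg y₀
  have key : ∀ s : ℝ, |s| = 1 → ∀ ε > 0, ∀ᶠ i in L,
      s * ∫ y, g y ∂(p₀ : Measure Y) - ε < s * ∫ y, g y ∂(p i : Measure Y) := by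
    intro s hs ε hε
    have hφ : (fun y => K * (1 + dist y y₀ ^ t) + s * g y) ∈ PhiT t Y :=
      PhiT.add ht (PhiT.const_mul (PhiT.add ht (PhiT.const 1) (PhiT.dist_rpow ht y₀)) K)
        (PhiT.const_mul hg s)
    have hφ0 : ∀ y, 0 ≤ K * (1 + dist y y₀ ^ t) + s * g y := fun y => by
      have h1 := neg_abs_le (s * g y)
      rw [abs_mul, hs, one_mul] at h1
      linarith [hK y]
    have hinteg : ∀ q : ProbabilityMeasure Y, MemPt t q →
        ∫ y, (K * (1 + dist y y₀ ^ t) + s * g y) ∂(q : Measure Y) =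
          K * (1 + ∫ y, dist y y₀ ^ t ∂(q : Measure Y)) + s * ∫ y, g y ∂(q : Measure Y) := by
      intro q hq
      have i1 := hq.integrable ht (PhiT.dist_rpow ht y₀)
      have i2 : Integrable (fun y => K * (1 + dist y y₀ ^ t)) (q : Measure Y) :=
        ((integrable_const 1).add i1).const_mul K
      rw [integral_add i2 ((hq.integrable ht hg).const_mul s), integral_const_mul, integral_const_mul,
        integral_add (integrable_const 1) i1]
      simp
    have h1 : ∀ᶠ i in L, ∫ y, (K * (1 + dist y y₀ ^ t) + s * g y) ∂(p₀ : Measure Y) - ε / 2 <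
        ∫ y, (K * (1 + dist y y₀ ^ t) + s * g y) ∂(p i : Measure Y) := by
      set I₀ := ∫ y, (K * (1 + dist y y₀ ^ t) + s * g y) ∂(p₀ : Measure Y) with hI₀
      by_cases hpos : I₀ - ε / 2 < 0
      · exact Eventually.of_forall fun i => hpos.trans_le (integral_nonneg hφ0)
      · have hlt : ENNReal.ofReal (I₀ - ε / 2) <
            ∫⁻ y, ENNReal.ofReal (K * (1 + dist y y₀ ^ t) + s * g y) ∂(p₀ : Measure Y) := by
          rw [← ofReal_integral_eq_lintegral_ofReal (hp₀.integrable ht hφ) (ae_of_all _ hφ0)]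
          exact (ENNReal.ofReal_lt_ofReal_iff_of_nonneg (not_lt.1 hpos)).2 (by linarith)
        filter_upwards [eventually_lt_lintegral_of_tendsto_map hk h
          (ENNReal.continuous_ofReal.comp hφ.1) hlt] with i hi
        simp only [Function.comp_apply] at hi
        rw [← ofReal_integral_eq_lintegral_ofReal ((hp i).integrable ht hφ)
          (ae_of_all _ hφ0)] at hi
        exact (ENNReal.ofReal_lt_ofReal_iff_of_nonneg (not_lt.1 hpos)).1 hi
    have h2 : ∀ᶠ i in L, K * ∫ y, dist y y₀ ^ t ∂(p i : Measure Y) <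
        K * ∫ y, dist y y₀ ^ t ∂(p₀ : Measure Y) + ε / 2 :=
      (hm.const_mul K).eventually (gt_mem_nhds (by linarith))
    filter_upwards [h1, h2] with i hi hi'
    rw [hinteg _ hp₀, hinteg _ (hp i)] at hi
    linarith
  refine tendsto_order.2 ⟨fun a ha => ?_, fun a ha => ?_⟩
  · filter_upwards [key 1 (by simp) _ (sub_pos.2 ha)] with i hi
    linarith
  · filter_upwards [key (-1) (by simp) _ (sub_pos.2 ha)] with i hi
    linarith

omit [Nonempty Y] in
/-- The Wasserstein topology is coarser than the one induced by weak convergence in a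
compactification together with convergence of the moment of order `t`. -/
theorem PtSpace.comap_nhds_le {Q : Type*} [MetricSpace Q] [CompactSpace Q]
    [MeasurableSpace Q] [BorelSpace Q] {k : Y → Q} (hk : IsEmbedding k) {t : ℝ} (ht : 0 ≤ t) (y₀ : Y)
    (p₀ : PtSpace t Y) :
    comap (fun p : PtSpace t Y => (p.1.map hk.continuous.measurable.aemeasurable,
      ENNReal.ofReal (∫ y, dist y y₀ ^ t ∂(p.1 : Measure Y))))
      (𝓝 (p₀.1.map hk.continuous.measurable.aemeasurable,
        ENNReal.ofReal (∫ y, dist y y₀ ^ t ∂(p₀.1 : Measure Y)))) ≤ 𝓝 p₀ := by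
  rw [(PtSpace.isInducing_integral t Y).nhds_eq_comap, ← tendsto_iff_comap, tendsto_pi_nhds]
  intro g
  have h0 := tendsto_comap (f := fun p : PtSpace t Y =>
    (p.1.map hk.continuous.measurable.aemeasurable,
      ENNReal.ofReal (∫ y, dist y y₀ ^ t ∂(p.1 : Measure Y))))
    (x := 𝓝 (p₀.1.map hk.continuous.measurable.aemeasurable,
        ENNReal.ofReal (∫ y, dist y y₀ ^ t ∂(p₀.1 : Measure Y))))
  rw [nhds_prod_eq, tendsto_prod_iff', ← nhds_prod_eq] at h0
  refine tendsto_integral_of_tendsto_map hk h0.1 ht (fun p => p.2) p₀.2 y₀ ?_ g.2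
  have h1 := (ENNReal.tendsto_toReal ENNReal.ofReal_ne_top).comp h0.2
  have h2 : ∀ p : PtSpace t Y, (ENNReal.ofReal (∫ y, dist y y₀ ^ t ∂(p.1 : Measure Y))).toReal =
      ∫ y, dist y y₀ ^ t ∂(p.1 : Measure Y) := fun p =>
    ENNReal.toReal_ofReal (integral_nonneg fun y => by positivity)
  simpa only [h2, Function.comp_def] using h1

omit [MetricSpace X] [PolishSpace X] [BorelSpace X] in
/-- If `D` bounds all the values of the dual problem, then there is a probability measure on the
compact space `W` (to be thought of as a compactification of `X × 𝒫_t(Y)` through `j`) which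
satisfies all linear constraints satisfied by a relaxed plan of cost at most `D`. -/
theorem exists_probabilityMeasure_integral_le_add {t : ℝ} (ht : 0 ≤ t)
    (C : X → ProbabilityMeasure Y → ℝ≥0∞) (μ : ProbabilityMeasure X) (ν : ProbabilityMeasure Y)
    (hν : MemPt t ν) {D : ℝ}
    (hD : ∀ (f : X → ℝ) (g : Y → ℝ), Integrable f (μ : Measure X) → g ∈ PhiT t Y →
      (∀ (x : X) (p : ProbabilityMeasure Y), MemPt t p →
        ENNReal.ofReal (f x + ∫ y, g y ∂(p : Measure Y)) ≤ C x p) →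
      ∫ x, f x ∂(μ : Measure X) + ∫ y, g y ∂(ν : Measure Y) ≤ D)
    {W : Type*} [TopologicalSpace W] [CompactSpace W] [T2Space W] [MeasurableSpace W]
    [BorelSpace W] (j : X → ProbabilityMeasure Y → W) :
    ∃ P : ProbabilityMeasure W, ∀ (h : C(W, ℝ)) (f : X → ℝ) (g : Y → ℝ) (c : ℝ), 0 ≤ c →
      Integrable f (μ : Measure X) → g ∈ PhiT t Y →
      (∀ (x : X) (p : ProbabilityMeasure Y), MemPt t p →
        ENNReal.ofReal (h (j x p) - f x - ∫ y, g y ∂(p : Measure Y)) ≤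
          ENNReal.ofReal c * C x p) →
      ∫ w, h w ∂(P : Measure W) ≤
        ∫ x, f x ∂(μ : Measure X) + ∫ y, g y ∂(ν : Measure Y) + c * D := by
  let K : Set (C(W, ℝ) × ℝ) := {z | ∃ (f : X → ℝ) (g : Y → ℝ) (c : ℝ), 0 ≤ c ∧
      Integrable f (μ : Measure X) ∧ g ∈ PhiT t Y ∧
      (∀ (x : X) (p : ProbabilityMeasure Y), MemPt t p →
        ENNReal.ofReal (z.1 (j x p) - f x - ∫ y, g y ∂(p : Measure Y)) ≤
          ENNReal.ofReal c * C x p) ∧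
      z.2 = ∫ x, f x ∂(μ : Measure X) + ∫ y, g y ∂(ν : Measure Y) + c * D}
  suffices h : ∃ P : ProbabilityMeasure W, ∀ p ∈ K, ∫ w, p.1 w ∂(P : Measure W) ≤ p.2 by
    obtain ⟨P, hP⟩ := h
    exact ⟨P, fun h f g c hc hf hg hfg => hP (h, _) ⟨f, g, c, hc, hf, hg, hfg, rfl⟩⟩
  refine exists_probabilityMeasure_integral_le K ?_ ?_ ?_ ?_
  · rintro ⟨h₁, v₁⟩ ⟨f₁, g₁, c₁, hc₁, hf₁, hg₁, hfg₁, rfl⟩ ⟨h₂, v₂⟩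
      ⟨f₂, g₂, c₂, hc₂, hf₂, hg₂, hfg₂, rfl⟩
    refine ⟨fun x => f₁ x + f₂ x, fun y => g₁ y + g₂ y, c₁ + c₂, add_nonneg hc₁ hc₂, hf₁.add hf₂,
      PhiT.add ht hg₁ hg₂, fun x p hp => ?_, ?_⟩
    · rw [ENNReal.ofReal_add hc₁ hc₂, add_mul,
        integral_add (hp.integrable ht hg₁) (hp.integrable ht hg₂)]
      refine le_trans ?_ (add_le_add (hfg₁ x p hp) (hfg₂ x p hp))
      refine (ENNReal.ofReal_le_ofReal (le_of_eq ?_)).trans ENNReal.ofReal_add_le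
      simp only [Prod.mk_add_mk, ContinuousMap.add_apply]
      ring
    · rw [integral_add hf₁ hf₂, integral_add (hν.integrable ht hg₁) (hν.integrable ht hg₂)]
      simp only [Prod.mk_add_mk]
      ring
  · rintro s hs ⟨h, v⟩ ⟨f, g, c, hc, hf, hg, hfg, rfl⟩
    refine ⟨fun x => s * f x, fun y => s * g y, s * c, by positivity, hf.const_mul s,
      PhiT.const_mul hg s, fun x p hp => ?_, ?_⟩
    · rw [ENNReal.ofReal_mul hs.le, mul_assoc, integral_const_mul]
      refine le_trans ?_ (mul_le_mul_right (hfg x p hp) _)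
      rw [← ENNReal.ofReal_mul hs.le]
      refine ENNReal.ofReal_le_ofReal (le_of_eq ?_)
      simp only [Prod.smul_mk, ContinuousMap.smul_apply, smul_eq_mul]
      ring
    · rw [integral_const_mul, integral_const_mul]
      simp only [Prod.smul_mk, smul_eq_mul]
      ring
  · intro c h hc
    refine ⟨fun _ => c, fun _ => 0, 0, le_rfl, integrable_const c, PhiT.const 0,
      fun x p _ => ?_, by simp⟩
    rw [ENNReal.ofReal_of_nonpos]
    · exact zero_le
    · simpa using hc (j x p)
  · rintro v ⟨f, g, c, hc, hf, hg, hfg, rfl⟩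
    set I := ∫ x, f x ∂(μ : Measure X) + ∫ y, g y ∂(ν : Measure Y) with hI
    have key : ∀ s : ℝ, 0 ≤ s → s * c ≤ 1 → -(s * I) ≤ D := fun s hs hsc => by
      have := hD (fun x => -s * f x) (fun y => -s * g y) (hf.const_mul _) (PhiT.const_mul hg _)
        fun x p hp => by
          rw [integral_const_mul]
          have h1 : -s * f x + -s * ∫ y, g y ∂(p : Measure Y) =
              s * ((0 : C(W, ℝ)) (j x p) - f x - ∫ y, g y ∂(p : Measure Y)) := by
            simp only [ContinuousMap.zero_apply]
            ring
          rw [h1, ENNReal.ofReal_mul hs]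
          refine (mul_le_mul_right (hfg x p hp) _).trans ?_
          rw [← mul_assoc, ← ENNReal.ofReal_mul hs]
          exact mul_le_of_le_one_left' (ENNReal.ofReal_le_one.2 hsc)
      rw [integral_const_mul, integral_const_mul] at this
      rw [hI]
      linarith
    rcases hc.eq_or_lt with hc0 | hcpos
    · rw [← hc0] at key ⊢
      by_contra! hneg
      have hI0 : 0 < -I := by linarith
      have := key ((|D| + 1) / (-I)) (by positivity) (by simp)
      rw [← mul_neg, div_mul_cancel₀ _ hI0.ne'] at this
      linarith [le_abs_self D]
    · have := key c⁻¹ (by positivity) (by rw [inv_mul_cancel₀ hcpos.ne'])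
      rw [← mul_neg, inv_mul_le_iff₀ hcpos] at this
      linarith

omit [Nonempty Y] [PolishSpace X] [MeasurableSpace X] [BorelSpace X] in
theorem eventually_lt_of_lowerSemicontinuous {Q₁ Q₂ Z : Type*} [TopologicalSpace Q₁] [MetricSpace Q₂]
    [CompactSpace Q₂] [MeasurableSpace Q₂] [BorelSpace Q₂] [TopologicalSpace Z]
    (h : Z ≃ₜ ProbabilityMeasure Q₂ × ℝ≥0∞) {i : X → Q₁} (hi : IsEmbedding i) {k : Y → Q₂}
    (hk : IsEmbedding k) {t : ℝ} (ht : 0 ≤ t) (y₀ : Y) (C : X → ProbabilityMeasure Y → ℝ≥0∞)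
    (hlsc : LowerSemicontinuous fun q : X × PtSpace t Y => C q.1 q.2.1)
    (s : X × PtSpace t Y) (a : ℝ≥0∞) (ha : a < C s.1 s.2.1) :
    ∀ᶠ w in 𝓝 (i s.1, h.symm (s.2.1.map hk.continuous.measurable.aemeasurable,
      ENNReal.ofReal (∫ y, dist y y₀ ^ t ∂(s.2.1 : Measure Y)))),
      ∀ s' : X × PtSpace t Y, (i s'.1, h.symm (s'.2.1.map hk.continuous.measurable.aemeasurable,
        ENNReal.ofReal (∫ y, dist y y₀ ^ t ∂(s'.2.1 : Measure Y)))) = w → a < C s'.1 s'.2.1 := by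
  set j : X × PtSpace t Y → Q₁ × Z := fun s =>
    (i s.1, h.symm (s.2.1.map hk.continuous.measurable.aemeasurable,
      ENNReal.ofReal (∫ y, dist y y₀ ^ t ∂(s.2.1 : Measure Y)))) with hj
  rw [← eventually_comap (f := j)]
  have hle : comap j (𝓝 (j s)) ≤ 𝓝 s := by
    have h1 : Tendsto (fun s' => (j s').1) (comap j (𝓝 (j s))) (𝓝 (j s).1) :=
      (continuous_fst.tendsto _).comp tendsto_comap
    have h2 : Tendsto (fun s' => h (j s').2) (comap j (𝓝 (j s))) (𝓝 (h (j s).2)) :=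
      ((h.continuous.comp continuous_snd).tendsto _).comp tendsto_comap
    simp only [hj, Homeomorph.apply_symm_apply] at h2
    have h3 : Tendsto (fun s' : X × PtSpace t Y => s'.1) (comap j (𝓝 (j s))) (𝓝 s.1) := by
      rw [hi.isInducing.nhds_eq_comap, tendsto_comap_iff]
      exact h1
    have h4 : Tendsto (fun s' : X × PtSpace t Y => s'.2) (comap j (𝓝 (j s))) (𝓝 s.2) :=
      Tendsto.mono_right (tendsto_comap_iff.2 h2) (PtSpace.comap_nhds_le hk ht y₀ s.2)
    exact h3.prodMk_nhds h4
  exact hle (hlsc s a ha)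

theorem measurable_toMeasure_of_continuous {Z Q : Type*} [TopologicalSpace Z] [MeasurableSpace Z]
    [OpensMeasurableSpace Z] [TopologicalSpace Q] [TopologicalSpace.PseudoMetrizableSpace Q]
    [MeasurableSpace Q] [BorelSpace Q]
    {e : Z → ProbabilityMeasure Q} (he : Continuous e) :
    Measurable fun z => (e z : Measure Q) := by
  refine Measurable.measure_of_isPiSystem_of_isProbabilityMeasure
    (BorelSpace.measurable_eq (α := Q)) isPiSystem_isOpen fun U hU => ?_
  refine LowerSemicontinuous.measurable ?_
  rw [lowerSemicontinuous_iff_le_liminf]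
  exact fun z => ProbabilityMeasure.le_liminf_measure_open_of_tendsto (he.tendsto z) hU

theorem exists_isEmbedding_compact (S : Type*) [TopologicalSpace S] [SecondCountableTopology S]
    [TopologicalSpace.MetrizableSpace S] :
    ∃ (Q : Type) (_ : MetricSpace Q) (_ : CompactSpace Q) (_ : MeasurableSpace Q)
      (_ : BorelSpace Q) (k : S → Q), IsEmbedding k := by
  let := TopologicalSpace.metrizableSpaceMetric S
  obtain ⟨k, hk⟩ := Metric.PiNatEmbed.exists_embedding_to_hilbert_cube (X := S)
  exact ⟨ℕ → unitInterval, TopologicalSpace.metrizableSpaceMetric _, inferInstance,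
    inferInstance, inferInstance, k, hk⟩

theorem exists_homeomorph_borelSpace (S : Type) [TopologicalSpace S] :
    ∃ (Z : Type) (_ : TopologicalSpace Z) (_ : MeasurableSpace Z) (_ : BorelSpace Z),
      Nonempty (Z ≃ₜ S) :=
  ⟨S, inferInstance, borel S, @BorelSpace.mk S _ (borel S) rfl, ⟨Homeomorph.refl S⟩⟩

omit [Nonempty Y] in
/-- If the mixture of random measures `E ω` on a compactification of `Y` is carried by `Y`, and its
moment of order `t` is finite and at least the mean of `m`, where `m ω` bounds the moment of `E ω`,
then almost every `E ω` is a measure on `Y` with moment `m ω`. -/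
theorem ae_exists_probabilityMeasure_of_bind_eq {Ω Q : Type*} [MeasurableSpace Ω]
    [MeasurableSpace Q] {P : Measure Ω} [IsProbabilityMeasure P] (E : Kernel Ω Q) [IsMarkovKernel E]
    {k : Y → Q} (hk : MeasurableEmbedding k) {r : Q → Y} (hr : Measurable r) (hrk : ∀ y, r (k y) = y)
    {t : ℝ} (ht : 0 ≤ t) (y₀ : Y) {ν : ProbabilityMeasure Y} (hν : MemPt t ν)
    (hbind : P.bind E = (ν : Measure Y).map k) {m : Ω → ℝ≥0∞} (hm : Measurable m)
    (hmν : ∫⁻ ω, m ω ∂P ≤ ∫⁻ y, ENNReal.ofReal (dist y y₀ ^ t) ∂(ν : Measure Y))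
    {d : Q → ℝ≥0∞} (hd : Measurable d) (hdk : ∀ y, d (k y) = ENNReal.ofReal (dist y y₀ ^ t))
    (hdm : ∀ᵐ ω ∂P, ∫⁻ q, d q ∂(E ω) ≤ m ω) :
    ∀ᵐ ω ∂P, ∃ p : ProbabilityMeasure Y, (p : Measure Y) = (E ω).map r ∧ MemPt t p ∧
      (p : Measure Y).map k = E ω ∧ ENNReal.ofReal (∫ y, dist y y₀ ^ t ∂(p : Measure Y)) = m ω := by
  have hfin : ∫⁻ y, ENNReal.ofReal (dist y y₀ ^ t) ∂(ν : Measure Y) ≠ ∞ :=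
    ((hasFiniteIntegral_iff_ofReal (ae_of_all _ fun y => by positivity)).1
      (hν.integrable ht (PhiT.dist_rpow ht y₀)).2).ne
  have hdE : ∫⁻ ω, ∫⁻ q, d q ∂(E ω) ∂P = ∫⁻ y, ENNReal.ofReal (dist y y₀ ^ t) ∂(ν : Measure Y) := by
    rw [← Measure.lintegral_bind E.aemeasurable hd.aemeasurable, hbind, lintegral_map hd hk.measurable]
    simp_rw [hdk]
  have heq : (fun ω => ∫⁻ q, d q ∂(E ω)) =ᵐ[P] m :=
    ae_eq_of_ae_le_of_lintegral_le hdm (hdE ▸ hfin) hm.aemeasurable (hmν.trans hdE.ge)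
  have hlt : ∀ᵐ ω ∂P, m ω < ∞ := ae_lt_top hm (hmν.trans_lt hfin.lt_top).ne
  have hrange : ∀ᵐ ω ∂P, ∀ᵐ q ∂(E ω), q ∈ Set.range k := by
    have h1 : (P.bind E) (Set.range k)ᶜ = 0 := by
      rw [hbind, Measure.map_apply hk.measurable hk.measurableSet_range.compl]
      simp
    rw [Measure.bind_apply hk.measurableSet_range.compl E.aemeasurable,
      lintegral_eq_zero_iff (E.measurable_coe hk.measurableSet_range.compl)] at h1
    exact h1
  filter_upwards [heq, hlt, hrange] with ω h1 h2 h3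
  have hprob : IsProbabilityMeasure ((E ω).map r) := Measure.isProbabilityMeasure_map hr.aemeasurable
  have hkr : (fun q => k (r q)) =ᵐ[E ω] id := by
    filter_upwards [h3] with q ⟨y, hy⟩
    rw [← hy, hrk]
    rfl
  have hlin : ∫⁻ y, ENNReal.ofReal (dist y y₀ ^ t) ∂((E ω).map r) = m ω := by
    rw [lintegral_map (by fun_prop) hr, ← h1]
    refine lintegral_congr_ae ?_
    filter_upwards [hkr] with q hq
    rw [← hdk, hq]
    rfl
  have hmem : MemPt t (⟨_, hprob⟩ : ProbabilityMeasure Y) :=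
    memPt_of_lintegral_ne_top ht y₀ (by simpa only [ProbabilityMeasure.coe_mk, hlin] using h2.ne)
  refine ⟨⟨_, hprob⟩, rfl, hmem, ?_, ?_⟩
  · rw [ProbabilityMeasure.coe_mk, Measure.map_map hk.measurable hr]
    exact (Measure.map_congr hkr).trans Measure.map_id
  · rw [ofReal_integral_eq_lintegral_ofReal (hmem.integrable ht (PhiT.dist_rpow ht y₀))
      (ae_of_all _ fun y => by positivity)]
    exact hlin

theorem measure_eq_of_forall_integral_le {Q : Type*} [MetricSpace Q] [CompactSpace Q]
    [MeasurableSpace Q] [BorelSpace Q] {m₁ m₂ : Measure Q} [IsFiniteMeasure m₁] [IsFiniteMeasure m₂]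
    (h : ∀ f : C(Q, ℝ), ∫ q, f q ∂m₁ ≤ ∫ q, f q ∂m₂) : m₁ = m₂ := by
  refine ext_of_forall_integral_eq_of_IsFiniteMeasure fun f => (h f.toContinuousMap).antisymm ?_
  have := h (-f.toContinuousMap)
  simp only [ContinuousMap.neg_apply, integral_neg, neg_le_neg_iff] at this
  exact this

theorem lintegral_iSup_le_of_integral_le {W : Type*} [TopologicalSpace W] [CompactSpace W]
    [MeasurableSpace W] [BorelSpace W] {P : Measure W} [IsFiniteMeasure P] {H : ℕ → C(W, ℝ≥0)}
    (hmono : Monotone H) {B : ℝ} (hB : ∀ n, ∫ w, (H n w : ℝ) ∂P ≤ B) :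
    ∫⁻ w, ⨆ n, (H n w : ℝ≥0∞) ∂P ≤ ENNReal.ofReal B := by
  rw [lintegral_iSup]
  · refine iSup_le fun n => ?_
    have hinteg : Integrable (fun w => (H n w : ℝ)) P :=
      (NNReal.continuous_coe.comp (map_continuous (H n))).integrable_of_hasCompactSupport
        (HasCompactSupport.of_compactSpace _)
    have h1 := ofReal_integral_eq_lintegral_ofReal hinteg (ae_of_all _ fun w => (H n w).2)
    simp only [ENNReal.ofReal_coe_nnreal] at h1
    rw [← h1]
    exact ENNReal.ofReal_le_ofReal (hB n)
  · exact fun n => (map_continuous (H n)).measurable.coe_nnreal_ennreal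
  · exact fun m n hmn w => ENNReal.coe_le_coe.2 (hmono hmn _)

/-- If `D` bounds all the values of the dual problem, then there is a relaxed plan, in which the
conditional law given `x` is itself random, of cost at most `D`. -/
theorem exists_relaxed_plan {t : ℝ} (ht : 0 ≤ t) (C : X → ProbabilityMeasure Y → ℝ≥0∞)
    (hlsc : LowerSemicontinuous fun q : X × PtSpace t Y => C q.1 q.2.1)
    (μ : ProbabilityMeasure X) (ν : ProbabilityMeasure Y) (hν : MemPt t ν) {D : ℝ}
    (hD : ∀ (f : X → ℝ) (g : Y → ℝ), Integrable f (μ : Measure X) → g ∈ PhiT t Y →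
      (∀ (x : X) (p : ProbabilityMeasure Y), MemPt t p →
        ENNReal.ofReal (f x + ∫ y, g y ∂(p : Measure Y)) ≤ C x p) →
      ∫ x, f x ∂(μ : Measure X) + ∫ y, g y ∂(ν : Measure Y) ≤ D) :
    ∃ (Z : Type) (_ : MeasurableSpace Z) (_ : StandardBorelSpace Z) (_ : Nonempty Z)
      (P : Measure (X × Z)) (_ : IsProbabilityMeasure P) (η : Kernel Z Y) (_ : IsMarkovKernel η)
      (Φ : X × Z → ℝ≥0∞), Measurable Φ ∧ P.fst = μ ∧ P.snd.bind η = ν ∧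
      (∀ᵐ w ∂P, ∃ p : ProbabilityMeasure Y, (p : Measure Y) = η w.2 ∧ MemPt t p ∧
        C w.1 p ≤ Φ w) ∧
      ∫⁻ w, Φ w ∂P ≤ ENNReal.ofReal D := by
  obtain ⟨Q₁, _, _, _, _, i, hi⟩ := exists_isEmbedding_compact X
  obtain ⟨Q₂, _, _, _, _, k, hk⟩ := exists_isEmbedding_compact Y
  obtain ⟨Z, _, _, _, ⟨h⟩⟩ := exists_homeomorph_borelSpace (ProbabilityMeasure Q₂ × ℝ≥0∞)
  have : CompactSpace Z := h.symm.compactSpace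
  have : TopologicalSpace.MetrizableSpace Z := h.isEmbedding.metrizableSpace
  have : PolishSpace Z := by
    let _ := TopologicalSpace.metrizableSpaceMetric Z
    infer_instance
  have : Nonempty X := μ.nonempty
  have y₀ : Y := Classical.arbitrary Y
  have x₀ : X := Classical.arbitrary X
  have hmi : MeasurableEmbedding i := hi.continuous.measurableEmbedding hi.injective
  have hmk : MeasurableEmbedding k := hk.continuous.measurableEmbedding hk.injective
  obtain ⟨r₁, hr₁, hri⟩ := hmi.exists_measurable_extend measurable_id fun _ => inferInstance
  obtain ⟨r₂, hr₂, hrk⟩ := hmk.exists_measurable_extend measurable_id fun _ => inferInstance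
  replace hri : ∀ x, r₁ (i x) = x := congrFun hri
  replace hrk : ∀ y, r₂ (k y) = y := congrFun hrk
  let j : X → ProbabilityMeasure Y → Q₁ × Z := fun x p =>
    (i x, h.symm (p.map hk.continuous.measurable.aemeasurable,
      ENNReal.ofReal (∫ y, dist y y₀ ^ t ∂(p : Measure Y))))
  obtain ⟨P, hP⟩ := exists_probabilityMeasure_integral_le_add ht C μ ν hν hD j
  have he : Continuous fun z => (h z).1 := continuous_fst.comp h.continuous
  have hmcont : Continuous fun z => (h z).2 := continuous_snd.comp h.continuous
  let E : Kernel Z Q₂ := ⟨fun z => ((h z).1 : Measure Q₂), measurable_toMeasure_of_continuous he⟩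
  have hE : IsMarkovKernel E := ⟨fun z => inferInstanceAs (IsProbabilityMeasure ((h z).1 : Measure Q₂))⟩
  have hEj : ∀ x p, E (j x p).2 = (p : Measure Y).map k := fun x p => by
    change ((h (h.symm _)).1 : Measure Q₂) = _
    rw [h.apply_symm_apply]
    rfl
  have hmj : ∀ x p, (h (j x p).2).2 = ENNReal.ofReal (∫ y, dist y y₀ ^ t ∂(p : Measure Y)) :=
    fun x p => by
      change (h (h.symm _)).2 = _
      rw [h.apply_symm_apply]
  have hcontE : ∀ g : C(Q₂, ℝ), Continuous fun z => ∫ q, g q ∂(E z) := fun g =>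
    (ProbabilityMeasure.continuous_integral_continuousMap g).comp he
  have hEjint : ∀ (g : C(Q₂, ℝ)) x p, ∫ q, g q ∂(E (j x p).2) = ∫ y, g (k y) ∂(p : Measure Y) :=
    fun g x p => by
      rw [hEj, integral_map hmk.measurable.aemeasurable (map_continuous g).aestronglyMeasurable]
  -- the marginals of `P`
  have hfst : (P : Measure (Q₁ × Z)).fst = (μ : Measure X).map i := by
    have : IsProbabilityMeasure ((μ : Measure X).map i) :=
      Measure.isProbabilityMeasure_map hmi.measurable.aemeasurable
    refine measure_eq_of_forall_integral_le fun f => ?_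
    rw [Measure.fst, integral_map measurable_fst.aemeasurable (map_continuous f).aestronglyMeasurable,
      integral_map hmi.measurable.aemeasurable (map_continuous f).aestronglyMeasurable]
    have hinteg : Integrable (fun x => f (i x)) (μ : Measure X) :=
      (integrable_const ‖f‖).mono' ((map_continuous f).comp hi.continuous).aestronglyMeasurable
        (ae_of_all _ fun x => f.norm_coe_le_norm _)
    simpa using hP (f.comp ⟨Prod.fst, continuous_fst⟩) (fun x => f (i x)) (fun _ => 0) 0 le_rfl
      hinteg (PhiT.const 0) (fun x p _ => by simp [j])
  have hbind : (P : Measure (Q₁ × Z)).snd.bind E = (ν : Measure Y).map k := by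
    have : IsProbabilityMeasure ((ν : Measure Y).map k) :=
      Measure.isProbabilityMeasure_map hmk.measurable.aemeasurable
    refine measure_eq_of_forall_integral_le fun g => ?_
    have hinteg : Integrable (fun q => g q) ((P : Measure (Q₁ × Z)).snd.bind E) :=
      (integrable_const ‖g‖).mono' (map_continuous g).aestronglyMeasurable
        (ae_of_all _ fun q => g.norm_coe_le_norm _)
    rw [(integral_bind_kernel _ _ hinteg).2.2, Measure.snd,
      integral_map measurable_snd.aemeasurable (hcontE g).aestronglyMeasurable,
      integral_map hmk.measurable.aemeasurable (map_continuous g).aestronglyMeasurable]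
    simpa using hP ⟨fun w => ∫ q, g q ∂(E w.2), (hcontE g).comp continuous_snd⟩ (fun _ => 0)
      (fun y => g (k y)) 0 le_rfl (integrable_const 0)
      (PhiT.of_bounded ((map_continuous g).comp hk.continuous) ‖g‖ fun y => g.norm_coe_le_norm _)
      (fun x p _ => by simp [hEjint])
  -- the moment coordinate
  have hmin : ∀ n : ℕ, Continuous fun w : Q₁ × Z => (min (h w.2).2 n).toNNReal := fun n =>
    ENNReal.continuousOn_toNNReal.comp_continuous
      ((hmcont.comp continuous_snd).min continuous_const)
      fun w => ((min_le_right _ _).trans_lt (ENNReal.natCast_lt_top n)).ne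
  have hminle : ∀ (n : ℕ) x (p : ProbabilityMeasure Y),
      ((min (h (j x p).2).2 n).toNNReal : ℝ) ≤ ∫ y, dist y y₀ ^ t ∂(p : Measure Y) := fun n x p => by
    rw [hmj]
    exact ENNReal.toReal_le_of_le_ofReal (integral_nonneg fun y => by positivity) (min_le_left _ _)
  have hmoment : ∫⁻ z, (h z).2 ∂(P : Measure (Q₁ × Z)).snd ≤
      ∫⁻ y, ENNReal.ofReal (dist y y₀ ^ t) ∂(ν : Measure Y) := by
    rw [Measure.snd, lintegral_map hmcont.measurable measurable_snd,
      ← ofReal_integral_eq_lintegral_ofReal (hν.integrable ht (PhiT.dist_rpow ht y₀))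
        (ae_of_all _ fun y => by positivity)]
    have hmono : Monotone fun n : ℕ =>
        (⟨fun w => (min (h w.2).2 n).toNNReal, hmin n⟩ : C(Q₁ × Z, ℝ≥0)) := fun a b hab w =>
      ENNReal.toNNReal_mono ((min_le_right _ _).trans_lt (ENNReal.natCast_lt_top b)).ne
        (min_le_min le_rfl (by exact_mod_cast hab))
    refine le_trans (lintegral_mono fun w => ?_) (lintegral_iSup_le_of_integral_le hmono fun n => ?_)
    · refine le_of_forall_lt fun a ha => ?_
      obtain ⟨n, hn⟩ := ENNReal.exists_nat_gt (ha.trans_le le_top).ne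
      refine lt_iSup_iff.2 ⟨n, ?_⟩
      rw [ContinuousMap.coe_mk,
        ENNReal.coe_toNNReal ((min_le_right _ _).trans_lt (ENNReal.natCast_lt_top n)).ne]
      exact lt_min ha hn
    · simpa using hP ⟨fun w => ((min (h w.2).2 n).toNNReal : ℝ),
        NNReal.continuous_coe.comp (hmin n)⟩ (fun _ => 0) (fun y => dist y y₀ ^ t) 0 le_rfl
        (integrable_const 0) (PhiT.dist_rpow ht y₀)
        (fun x p _ => by
          rw [ENNReal.ofReal_of_nonpos]
          · exact zero_le
          · simpa using hminle n x p)
  obtain ⟨d, hdmono, hdle, hdsup⟩ := exists_monotone_continuousMap_iSup_eq k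
    (fun y => ENNReal.ofReal (dist y y₀ ^ t)) fun y b hb => by
      have h1 := (ENNReal.continuous_ofReal.comp
        (PhiT.dist_rpow (Z := Y) ht y₀).1).continuousAt.eventually (lt_mem_nhds hb)
      rwa [hk.isInducing.nhds_eq_comap, eventually_comap] at h1
  have hdm : ∀ᵐ z ∂(P : Measure (Q₁ × Z)).snd,
      ∫⁻ q, ⨆ n, (d n q : ℝ≥0∞) ∂(E z) ≤ (h z).2 := by
    have hle : ∀ n, ∀ᵐ z ∂(P : Measure (Q₁ × Z)).snd,
        ∫ q, (d n q : ℝ) ∂(E z) ≤ ((min (h z).2 n).toNNReal : ℝ) := fun n => by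
      let dn : C(Q₂, ℝ) := ⟨fun q => (d n q : ℝ), NNReal.continuous_coe.comp (map_continuous (d n))⟩
      have hcE : Continuous fun z => ∫ q, (d n q : ℝ) ∂(E z) := hcontE dn
      have hcm : Continuous fun w : Q₁ × Z => ((min (h w.2).2 n).toNNReal : ℝ) :=
        NNReal.continuous_coe.comp (hmin n)
      let θ : C(Q₁ × Z, ℝ) :=
        ⟨fun w => max 0 (∫ q, (d n q : ℝ) ∂(E w.2) - ((min (h w.2).2 n).toNNReal : ℝ)),
          continuous_const.max ((hcE.comp continuous_snd).sub hcm)⟩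
      have hθj : ∀ x p, MemPt t p → θ (j x p) ≤ 0 := fun x p hp => by
        refine max_le le_rfl (sub_nonpos.2 ?_)
        have hdi : Integrable (fun y => (d n (k y) : ℝ)) (p : Measure Y) :=
          (integrable_const (n : ℝ)).mono'
            (dn.continuous.comp hk.continuous).aestronglyMeasurable
            (ae_of_all _ fun y => by
              rw [Real.norm_of_nonneg (NNReal.coe_nonneg _)]
              exact_mod_cast hdle n (k y))
        have h1 : ∫ y, (d n (k y) : ℝ) ∂(p : Measure Y) ≤ n := by
          refine (integral_mono hdi (integrable_const (n : ℝ)) fun y => ?_).trans_eq (by simp)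
          exact_mod_cast hdle n (k y)
        have h2 : ∫ y, (d n (k y) : ℝ) ∂(p : Measure Y) ≤ ∫ y, dist y y₀ ^ t ∂(p : Measure Y) := by
          refine integral_mono hdi (hp.integrable ht (PhiT.dist_rpow ht y₀)) fun y => ?_
          refine ENNReal.toReal_le_of_le_ofReal (a := d n (k y)) (by positivity) ?_
          exact (le_iSup (fun n => (d n (k y) : ℝ≥0∞)) n).trans_eq (hdsup y)
        rw [show ∫ q, (d n q : ℝ) ∂(E (j x p).2) = ∫ y, (d n (k y) : ℝ) ∂(p : Measure Y) from
          hEjint dn x p, hmj]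
        refine (ENNReal.ofReal_le_iff_le_toReal
          ((min_le_right _ _).trans_lt (ENNReal.natCast_lt_top n)).ne).1 (le_min ?_ ?_)
        · exact ENNReal.ofReal_le_ofReal h2
        · exact (ENNReal.ofReal_le_ofReal h1).trans_eq (ENNReal.ofReal_natCast n)
      have hθP : ∫ w, θ w ∂(P : Measure (Q₁ × Z)) ≤ 0 := by
        simpa using hP θ (fun _ => 0) (fun _ => 0) 0 le_rfl (integrable_const 0) (PhiT.const 0)
          (fun x p hp => by simpa using hθj x p hp)
      have hθ0 : 0 ≤ fun w => θ w := fun w => le_max_left _ _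
      have hθae := (integral_eq_zero_iff_of_nonneg hθ0
        (θ.continuous.integrable_of_hasCompactSupport (HasCompactSupport.of_compactSpace _))).1
        (hθP.antisymm (integral_nonneg hθ0))
      have hmz : Continuous fun z : Z => ((min (h z).2 n).toNNReal : ℝ) :=
        hcm.comp (continuous_const.prodMk continuous_id : Continuous fun z => (i x₀, z))
      rw [Measure.snd, ae_map_iff measurable_snd.aemeasurable
        (measurableSet_le hcE.measurable hmz.measurable)]
      filter_upwards [hθae] with w hw
      exact sub_nonpos.1 ((le_max_right _ _).trans_eq hw)
    filter_upwards [ae_all_iff.2 hle] with z hz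
    rw [lintegral_iSup (fun n => (map_continuous (d n)).measurable.coe_nnreal_ennreal)
      fun m n hmn q => ENNReal.coe_le_coe.2 (hdmono hmn _)]
    refine iSup_le fun n => ?_
    have hdi : Integrable (fun q => (d n q : ℝ)) (E z) :=
      (NNReal.continuous_coe.comp (map_continuous (d n))).integrable_of_hasCompactSupport
        (HasCompactSupport.of_compactSpace _)
    have h1 := ofReal_integral_eq_lintegral_ofReal hdi (ae_of_all _ fun q => (d n q).2)
    simp only [ENNReal.ofReal_coe_nnreal] at h1
    rw [← h1]
    exact (ENNReal.ofReal_le_of_le_toReal (hz n)).trans (min_le_left _ _)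
  have hae := ae_exists_probabilityMeasure_of_bind_eq E hmk hr₂ hrk ht y₀ hν hbind
    hmcont.measurable hmoment
    (Measurable.iSup fun n => (map_continuous (d n)).measurable.coe_nnreal_ennreal) hdsup hdm
  -- the cost
  let _ := TopologicalSpace.metrizableSpaceMetric Z
  obtain ⟨H, hHmono, -, hHsup⟩ := exists_monotone_continuousMap_iSup_eq
    (fun s : X × PtSpace t Y => j s.1 s.2.1) (fun s => C s.1 s.2.1)
    (eventually_lt_of_lowerSemicontinuous h hi hk ht y₀ C hlsc)
  have hcost : ∫⁻ w, ⨆ n, (H n w : ℝ≥0∞) ∂(P : Measure (Q₁ × Z)) ≤ ENNReal.ofReal D := by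
    refine lintegral_iSup_le_of_integral_le hHmono fun n => ?_
    simpa using hP ⟨fun w => (H n w : ℝ), NNReal.continuous_coe.comp (map_continuous (H n))⟩
      (fun _ => 0) (fun _ => 0) 1 zero_le_one (integrable_const 0) (PhiT.const 0)
      (fun x p hp => by
        simp only [ContinuousMap.coe_mk, sub_zero, integral_zero, ENNReal.ofReal_coe_nnreal,
          ENNReal.ofReal_one, one_mul]
        exact (le_iSup (fun n => (H n (j x p) : ℝ≥0∞)) n).trans_eq (hHsup (x, ⟨p, hp⟩)))
  have hΦ : Measurable fun w : Q₁ × Z => ⨆ n, (H n w : ℝ≥0∞) :=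
    Measurable.iSup fun n => (map_continuous (H n)).measurable.coe_nnreal_ennreal
  have hr₁' : Measurable fun w : Q₁ × Z => (r₁ w.1, w.2) :=
    (hr₁.comp measurable_fst).prodMk measurable_snd
  have hi' : Measurable fun w : X × Z => (i w.1, w.2) :=
    (hmi.measurable.comp measurable_fst).prodMk measurable_snd
  have hsnd : ((P : Measure (Q₁ × Z)).map fun w => (r₁ w.1, w.2)).snd =
      (P : Measure (Q₁ × Z)).snd := Measure.snd_map_prodMk (hr₁.comp measurable_fst)
  refine ⟨Z, inferInstance, inferInstance, ⟨h.symm (⟨Measure.dirac (k y₀), inferInstance⟩, 0)⟩,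
    (P : Measure (Q₁ × Z)).map fun w => (r₁ w.1, w.2),
    Measure.isProbabilityMeasure_map hr₁'.aemeasurable, E.map r₂, Kernel.IsMarkovKernel.map E hr₂,
    fun w => ⨆ n, (H n (i w.1, w.2) : ℝ≥0∞), hΦ.comp hi', ?_, ?_, ?_, ?_⟩
  · rw [Measure.fst_map_prodMk measurable_snd]
    change (P : Measure (Q₁ × Z)).map (r₁ ∘ Prod.fst) = _
    rw [← Measure.map_map hr₁ measurable_fst, ← Measure.fst, hfst,
      Measure.map_map hr₁ hmi.measurable]
    convert Measure.map_id
    exact funext hri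
  · rw [hsnd, ← Measure.map_comp _ _ hr₂, hbind, Measure.map_map hr₂ hmk.measurable]
    convert Measure.map_id
    exact funext hrk
  · rw [← hsnd] at hae
    filter_upwards [ae_of_ae_map measurable_snd.aemeasurable hae] with w ⟨p, hp, hpt, hpk, hpm⟩
    refine ⟨p, by rw [hp, Kernel.map_apply _ hr₂], hpt, ?_⟩
    have hj : j w.1 p = (i w.1, w.2) := by
      refine Prod.ext rfl ?_
      change h.symm _ = w.2
      rw [Homeomorph.symm_apply_eq]
      exact Prod.ext (Subtype.ext hpk) hpm
    exact (hHsup (w.1, ⟨p, hpt⟩)).ge.trans_eq (by simp only [hj])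
  · refine le_trans (le_of_eq ?_) hcost
    refine (lintegral_map (f := fun w : X × Z => ⨆ n, (H n (i w.1, w.2) : ℝ≥0∞))
      (hΦ.comp hi') hr₁').trans ?_
    have h1 : ∀ᵐ q ∂(P : Measure (Q₁ × Z)).fst, i (r₁ q) = q := by
      rw [hfst, hmi.ae_map_iff]
      exact ae_of_all _ fun x => by rw [hri]
    refine lintegral_congr_ae ?_
    filter_upwards [ae_of_ae_map measurable_fst.aemeasurable h1] with w hw
    simp only [hw]

omit [BorelSpace X] in
/-- A relaxed plan, in which the conditional law given `x` is itself random, can be averaged to a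
coupling without increasing the cost. -/
theorem exists_isCoupling_weakCost_le {t : ℝ} (ht : 0 ≤ t) (C : X → ProbabilityMeasure Y → ℝ≥0∞)
    (hlsc : LowerSemicontinuous fun q : X × PtSpace t Y => C q.1 q.2.1)
    (hconv : ∀ x : X, ∀ p q r : ProbabilityMeasure Y, MemPt t p → MemPt t q →
      ∀ a b : ℝ≥0, a + b = 1 →
      (r : Measure Y) = (a : ℝ≥0∞) • (p : Measure Y) + (b : ℝ≥0∞) • (q : Measure Y) →
      C x r ≤ (a : ℝ≥0∞) * C x p + (b : ℝ≥0∞) * C x q)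
    (μ : ProbabilityMeasure X) (ν : ProbabilityMeasure Y) (hν : MemPt t ν)
    {Z : Type*} [MeasurableSpace Z] [StandardBorelSpace Z] [Nonempty Z]
    (P : Measure (X × Z)) [IsProbabilityMeasure P] (η : Kernel Z Y) [IsMarkovKernel η]
    (Φ : X × Z → ℝ≥0∞) (hΦ : Measurable Φ) (hfst : P.fst = μ) (hsnd : P.snd.bind η = ν)
    (hP : ∀ᵐ w ∂P, ∃ p : ProbabilityMeasure Y, (p : Measure Y) = η w.2 ∧ MemPt t p ∧
      C w.1 p ≤ Φ w) :
    ∃ π : ProbabilityMeasure (X × Y), IsCoupling μ ν π ∧ weakCost C μ π ≤ ∫⁻ w, Φ w ∂P := by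
  have hdis : P.fst ⊗ₘ P.condKernel = P := P.disintegrate P.condKernel
  let π : Measure (X × Y) := (μ : Measure X) ⊗ₘ (η ∘ₖ P.condKernel)
  have hπ : IsProbabilityMeasure π := by infer_instance
  have hπ1 : π.fst = μ := Measure.fst_compProd _ _
  have hπ2 : π.snd = ν := by
    rw [Measure.snd_compProd, ← Measure.comp_assoc, ← hsnd, ← hfst,
      ← Measure.snd_compProd P.fst, hdis]
  have hcond : ∀ᵐ x ∂(μ : Measure X), (η ∘ₖ P.condKernel) x = π.condKernel x := by
    have := eq_condKernel_of_measure_eq_compProd (ρ := π) (η ∘ₖ P.condKernel) (by rw [hπ1])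
    rwa [hπ1] at this
  refine ⟨⟨π, hπ⟩, ⟨hπ1, hπ2⟩, ?_⟩
  have hb : (ν : Measure Y) = (μ : Measure X).bind (η ∘ₖ P.condKernel) := by
    rw [← hπ2, Measure.snd_compProd]
  obtain ⟨z₀, hz₀⟩ := hν
  rw [hb] at hz₀
  have hae : ∀ᵐ x ∂(μ : Measure X), ∀ᵐ z ∂(P.condKernel x), ∃ p : ProbabilityMeasure Y,
      (p : Measure Y) = η z ∧ MemPt t p ∧ C x p ≤ Φ (x, z) := by
    rw [← hdis, hfst] at hP
    exact Measure.ae_ae_of_ae_compProd hP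
  have hlint : ∫⁻ w, Φ w ∂P = ∫⁻ x, ∫⁻ z, Φ (x, z) ∂(P.condKernel x) ∂(μ : Measure X) := by
    rw [← hfst, Measure.lintegral_condKernel hΦ]
  rw [hlint]
  refine lintegral_mono_ae ?_
  filter_upwards [hcond, hae, (integral_bind_kernel _ _ hz₀).1] with x hx hx' hx''
  rw [hx] at hx''
  refine le_lintegral_of_eq_bind ht (C x) ?_ (hconv x) (P.condKernel x) η
    (disint ⟨π, hπ⟩ x) ?_ ⟨z₀, hx''⟩ _ hx'
  · exact fun p a ha => (Continuous.prodMk_right x).continuousAt.eventually (hlsc (x, p) a ha)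
  · exact hx.symm.trans (Kernel.comp_apply _ _ _)

/-- Kantorovich duality for weak transport (Theorem 3.2). -/
theorem weak_transport_duality
    (t : ℝ) (ht : 1 ≤ t) (C : X → ProbabilityMeasure Y → ℝ≥0∞)
    (hlsc : LowerSemicontinuous fun q : X × PtSpace t Y => C q.1 q.2.1)
    (hconv : ∀ x : X, ∀ p q r : ProbabilityMeasure Y, MemPt t p → MemPt t q →
      ∀ a b : ℝ≥0, a + b = 1 →
      (r : Measure Y) = (a : ℝ≥0∞) • (p : Measure Y) + (b : ℝ≥0∞) • (q : Measure Y) →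
      C x r ≤ (a : ℝ≥0∞) * C x p + (b : ℝ≥0∞) * C x q)
    (μ : ProbabilityMeasure X) (ν : ProbabilityMeasure Y) (hν : MemPt t ν) :
    (⨅ (π : ProbabilityMeasure (X × Y)) (_ : IsCoupling μ ν π), weakCost C μ π) =
      ⨆ (f : X → ℝ) (g : Y → ℝ) (_ : Integrable f (μ : Measure X)) (_ : g ∈ PhiT t Y)
        (_ : ∀ (x : X) (p : ProbabilityMeasure Y), MemPt t p →
          ENNReal.ofReal (f x + ∫ y, g y ∂(p : Measure Y)) ≤ C x p),
        ENNReal.ofReal (∫ x, f x ∂(μ : Measure X) + ∫ y, g y ∂(ν : Measure Y)) := by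
  have ht' : 0 ≤ t := zero_le_one.trans ht
  refine le_antisymm ?_ ?_
  · set S : ℝ≥0∞ := ⨆ (f : X → ℝ) (g : Y → ℝ) (_ : Integrable f (μ : Measure X))
      (_ : g ∈ PhiT t Y) (_ : ∀ (x : X) (p : ProbabilityMeasure Y), MemPt t p →
        ENNReal.ofReal (f x + ∫ y, g y ∂(p : Measure Y)) ≤ C x p),
      ENNReal.ofReal (∫ x, f x ∂(μ : Measure X) + ∫ y, g y ∂(ν : Measure Y)) with hS
    rcases eq_or_ne S ∞ with hST | hST
    · exact hST ▸ le_top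
    obtain ⟨Z, _, _, _, P, _, η, _, Φ, hΦ, hfst, hsnd, hP, hcost⟩ :=
      exists_relaxed_plan ht' C hlsc μ ν hν (D := S.toReal) fun f g hf hg hfg =>
        (ENNReal.ofReal_le_iff_le_toReal hST).1 <|
          le_iSup_of_le f <| le_iSup_of_le g <| le_iSup_of_le hf <| le_iSup_of_le hg <|
            le_iSup_of_le hfg le_rfl
    obtain ⟨π, hπ, hle⟩ :=
      exists_isCoupling_weakCost_le ht' C hlsc hconv μ ν hν P η Φ hΦ hfst hsnd hP
    exact iInf₂_le_of_le π hπ (hle.trans (hcost.trans_eq (ENNReal.ofReal_toReal hST)))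
  · exact iSup_le fun f => iSup_le fun g => iSup_le fun hf => iSup_le fun hg => iSup_le fun hfg =>
      le_iInf₂ fun π hπ => ofReal_integral_add_integral_le_weakCost ht' hν hπ hf hg hfg

end
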